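/- Consider a finite-horizon MDP (S, A, H, P, r, s₁) with r ≥ 0 and with Q*_h(s,a) ≤ 1 for all (s,a) and all h ∈ {1,…,H}. Let P̂ assign to each (s,a) a probability vector P̂_{s,a} on S, let N : S×A → ℝ with N(s,a) ≥ 1, let ι ≥ 0, and let ε₁ ∈ [0, 1/3]. Assume that for every (s,a) and every v ∈ ℝ^S with 0 ≤ v(s') ≤ 2 for all s': |(P̂_{s,a} − P_{s,a})·v| ≤ 2·√( 𝕍(P̂_{s,a}, v)·ι / N(s,a) ) + 14ι/(3·N(s,a)) + 3ε₁. Define backwards: V_{H+1} ≡ 0, b_h(s,a) = 2·√( 𝕍(P̂_{s,a}, V_{h+1})·ι / N(s,a) ) + 14ι/(3·N(s,a)), Q_h(s,a) = min{ r(s,a) + P̂_{s,a}·V_{h+1} + b_h(s,a), 1 } + 3ε₁, and V_h(s) = max_a Q_h(s,a). Then Q_h(s,a) ≥ Q*_h(s,a) for every (s,a) and every h ∈ {1,…,H}. -/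

import Mathlib

open Finset

/-- `𝕍(p,v) = Σᵢ pᵢ vᵢ² − (p·v)²`. -/
def pVar {S : Type*} [Fintype S] (p v : S → ℝ) : ℝ :=
  (∑ s, p s * v s ^ 2) - (∑ s, p s * v s) ^ 2

/-- Optimism of the `Q-Computing` procedure: under the good-event concentration
hypothesis, the Q-function computed by the empirical-Bernstein-bonus backward
recursion is an entrywise upper bound on the optimal Q-function. -/
theorem optimism_Q_computing
    {S A : Type*} [Fintype S] [Fintype A] [Nonempty A]
    (H : ℕ) (P : S → A → S → ℝ)
    (hP : ∀ s a, (∀ s', 0 ≤ P s a s') ∧ ∑ s', P s a s' = 1)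
    (r : S → A → ℝ) (hr : ∀ s a, 0 ≤ r s a) (s₁ : S)
    -- the optimal value functions of the MDP, defined by backward recursion
    (Qstar : ℕ → S → A → ℝ) (Vstar : ℕ → S → ℝ)
    (hVstarH : ∀ s, Vstar (H + 1) s = 0)
    (hQstar : ∀ h, 1 ≤ h → h ≤ H → ∀ s a,
      Qstar h s a = r s a + ∑ s', P s a s' * Vstar (h + 1) s')
    (hVstar : ∀ h, 1 ≤ h → h ≤ H → ∀ s, Vstar h s = ⨆ a, Qstar h s a)
    -- the optimal Q-function is bounded by 1
    (hQstar1 : ∀ h, 1 ≤ h → h ≤ H → ∀ s a, Qstar h s a ≤ 1)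
    -- the empirical kernel and counts
    (Phat : S → A → S → ℝ)
    (hPhat : ∀ s a, (∀ s', 0 ≤ Phat s a s') ∧ ∑ s', Phat s a s' = 1)
    (N : S → A → ℝ) (hN : ∀ s a, 1 ≤ N s a)
    (ι ε₁ : ℝ) (hι : 0 ≤ ι) (hε₁ : ε₁ ∈ Set.Icc (0 : ℝ) (1 / 3))
    -- the good-event concentration hypothesis
    (hconc : ∀ s a, ∀ v : S → ℝ, (∀ s', 0 ≤ v s' ∧ v s' ≤ 2) →
      |∑ s', (Phat s a s' - P s a s') * v s'| ≤
        2 * Real.sqrt (pVar (Phat s a) v * ι / N s a) + 14 * ι / (3 * N s a) + 3 * ε₁)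
    -- the Q-Computing backward recursion
    (b : ℕ → S → A → ℝ) (Q : ℕ → S → A → ℝ) (V : ℕ → S → ℝ)
    (hVH : ∀ s, V (H + 1) s = 0)
    (hb : ∀ h, 1 ≤ h → h ≤ H → ∀ s a, b h s a =
      2 * Real.sqrt (pVar (Phat s a) (V (h + 1)) * ι / N s a) + 14 * ι / (3 * N s a))
    (hQ : ∀ h, 1 ≤ h → h ≤ H → ∀ s a,
      Q h s a = min (r s a + ∑ s', Phat s a s' * V (h + 1) s' + b h s a) 1 + 3 * ε₁)
    (hV : ∀ h, 1 ≤ h → h ≤ H → ∀ s, V h s = ⨆ a, Q h s a) :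
    ∀ h, 1 ≤ h → h ≤ H → ∀ s a, Qstar h s a ≤ Q h s a := by
  obtain ⟨hε0, hε1⟩ := hε₁
  have step : ∀ h, 1 ≤ h → h ≤ H →
      (∀ s, Vstar (h + 1) s ≤ V (h + 1) s ∧ 0 ≤ V (h + 1) s ∧ V (h + 1) s ≤ 2) →
      ∀ s a, Qstar h s a ≤ Q h s a ∧ 0 ≤ Q h s a ∧ Q h s a ≤ 2 := by
    intro h h1 hH ih s a
    have hb0 : 0 ≤ b h s a := by
      rw [hb h h1 hH]
      have := hN s a
      positivity
    have hsum : 0 ≤ ∑ s', Phat s a s' * V (h + 1) s' :=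
      Finset.sum_nonneg fun s' _ => mul_nonneg ((hPhat s a).1 s') (ih s').2.1
    have hmono : ∑ s', P s a s' * Vstar (h + 1) s' ≤ ∑ s', P s a s' * V (h + 1) s' :=
      Finset.sum_le_sum fun s' _ => mul_le_mul_of_nonneg_left (ih s').1 ((hP s a).1 s')
    have hc := (abs_le.mp (hconc s a (V (h + 1)) fun s' => (ih s').2)).1
    rw [← hb h h1 hH] at hc
    simp only [sub_mul, Finset.sum_sub_distrib] at hc
    have hq1 := hQstar1 h h1 hH s a
    have hq := hQstar h h1 hH s a
    have hr0 := hr s a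
    rw [hQ h h1 hH]
    refine ⟨?_, ?_, ?_⟩
    · rw [← sub_le_iff_le_add]
      exact le_min (by linarith) (by linarith)
    · exact add_nonneg (le_min (by linarith) (by linarith)) (by linarith)
    · have := min_le_right (r s a + ∑ s', Phat s a s' * V (h + 1) s' + b h s a) 1
      linarith
  have key : ∀ k h, 1 ≤ h → h + k = H + 1 →
      ∀ s, Vstar h s ≤ V h s ∧ 0 ≤ V h s ∧ V h s ≤ 2 := by
    intro k
    induction k with
    | zero =>
      intro h h1 hk s
      have : h = H + 1 := by omega
      subst this
      rw [hVstarH, hVH]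
      norm_num
    | succ k ih =>
      intro h h1 hk s
      have hH : h ≤ H := by omega
      have st := step h h1 hH (ih (h + 1) (by omega) (by omega)) s
      rw [hVstar h h1 hH, hV h h1 hH]
      exact ⟨ciSup_mono (Set.finite_range _).bddAbove fun a => (st a).1,
        Real.iSup_nonneg fun a => (st a).2.1, ciSup_le fun a => (st a).2.2⟩
  intro h h1 hH s a
  exact (step h h1 hH (key (H - h) (h + 1) (by omega) (by omega)) s a).1
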